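/- arXiv:2205.11054 — 4 statements merged into one kernel-verified Lean document; each statement's English description precedes it below -/
import Mathlib

section
/- Let (T, F) be a pretorsion theory in a category C. Then T is closed under extremal quotients: if q : X → Y is an extremal epimorphism and X ∈ T, then Y ∈ T. Dually, F is closed under extremal subobjects: if m : X → Y is an extremal monomorphism and Y ∈ F, then X ∈ F. -/
/- Basic notions of pretorsion theories, after Borceux, Campanini, Gran,
"Pretorsion theories in lextensive categories". -/

namespace PretorsionPaper

open CategoryTheory CategoryTheory.Limits

universe w₂ w₁ v' u' v u

variable {C : Type u} [Category.{v} C]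

/-- A morphism is `Z`-trivial if it factors through an object of `Z`. -/
def IsTrivial (Z : Set C) {X Y : C} (f : X ⟶ Y) : Prop :=
  ∃ (W : C) (g : X ⟶ W) (h : W ⟶ Y), W ∈ Z ∧ g ≫ h = f

/-- `ε : K ⟶ A` is a `Z`-kernel of `f : A ⟶ B`. -/
structure IsZKernel (Z : Set C) {K A B : C} (ε : K ⟶ A) (f : A ⟶ B) : Prop where
  comp_trivial : IsTrivial Z (ε ≫ f)
  lift : ∀ {Y : C} (l : Y ⟶ A), IsTrivial Z (l ≫ f) → ∃! l' : Y ⟶ K, l' ≫ ε = l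

/-- `q : B ⟶ Q` is a `Z`-cokernel of `f : A ⟶ B`. -/
structure IsZCokernel (Z : Set C) {A B Q : C} (q : B ⟶ Q) (f : A ⟶ B) : Prop where
  comp_trivial : IsTrivial Z (f ≫ q)
  desc : ∀ {W : C} (h : B ⟶ W), IsTrivial Z (f ≫ h) → ∃! h' : Q ⟶ W, q ≫ h' = h

/-- A pretorsion theory `(T, F)` in a category `C`: two replete full subcategories
(given by their classes of objects) such that every morphism from `T` to `F` is
`Z`-trivial (`Z := T ∩ F`) and every object fits in a short `Z`-exact sequence
`T₀ ⟶ X ⟶ F₀` with `T₀ ∈ T`, `F₀ ∈ F`. -/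
structure PretorsionTheory (C : Type u) [Category.{v} C] where
  T : Set C
  F : Set C
  replete_T : ∀ {X Y : C}, (X ≅ Y) → X ∈ T → Y ∈ T
  replete_F : ∀ {X Y : C}, (X ≅ Y) → X ∈ F → Y ∈ F
  hom_trivial : ∀ {X Y : C}, X ∈ T → Y ∈ F → ∀ f : X ⟶ Y, IsTrivial (T ∩ F) f
  exact_seq : ∀ X : C, ∃ (T₀ F₀ : C) (e : T₀ ⟶ X) (h : X ⟶ F₀),
    T₀ ∈ T ∧ F₀ ∈ F ∧ IsZKernel (T ∩ F) e h ∧ IsZCokernel (T ∩ F) h e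

/-- The class of trivial objects of a pretorsion theory. -/
def PretorsionTheory.Z (P : PretorsionTheory C) : Set C := P.T ∩ P.F

/-- A morphism is an extremal epimorphism if it is an epimorphism and in any
factorization through a monomorphism, the monomorphism is an isomorphism. -/
def ExtremalEpi {X Y : C} (q : X ⟶ Y) : Prop :=
  Epi q ∧ ∀ {W : C} (e : X ⟶ W) (m : W ⟶ Y), Mono m → e ≫ m = q → IsIso m

/-- A morphism is an extremal monomorphism if it is a monomorphism and in any
factorization through an epimorphism, the epimorphism is an isomorphism. -/
def ExtremalMono {X Y : C} (m : X ⟶ Y) : Prop :=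
  Mono m ∧ ∀ {W : C} (e : X ⟶ W) (f : W ⟶ Y), Epi e → e ≫ f = m → IsIso e

theorem IsTrivial.precomp {Z : Set C} {W X Y : C} {f : X ⟶ Y} (hf : IsTrivial Z f)
    (g : W ⟶ X) : IsTrivial Z (g ≫ f) := by
  obtain ⟨V, a, b, hV, rfl⟩ := hf
  exact ⟨V, g ≫ a, b, hV, Category.assoc _ _ _⟩

theorem IsTrivial.postcomp {Z : Set C} {X Y W : C} {f : X ⟶ Y} (hf : IsTrivial Z f)
    (g : Y ⟶ W) : IsTrivial Z (f ≫ g) := by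
  obtain ⟨V, a, b, hV, rfl⟩ := hf
  exact ⟨V, a, b ≫ g, hV, (Category.assoc _ _ _).symm⟩

theorem IsZKernel.mono {Z : Set C} {K A B : C} {ε : K ⟶ A} {f : A ⟶ B}
    (h : IsZKernel Z ε f) : Mono ε where
  right_cancellation a b hab :=
    (h.lift (b ≫ ε) (by simpa using h.comp_trivial.precomp b)).unique hab rfl

theorem IsZCokernel.epi {Z : Set C} {A B Q : C} {q : B ⟶ Q} {f : A ⟶ B}
    (h : IsZCokernel Z q f) : Epi q where
  left_cancellation a b hab :=
    (h.desc (q ≫ b) (by simpa using h.comp_trivial.postcomp b)).unique hab rfl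

/-- `T` is closed under extremal quotients and `F` is closed under
extremal subobjects. -/
theorem torsion_closed_extremal_quotients_and_torsionFree_closed_extremal_subobjects
    (P : PretorsionTheory C) :
    (∀ {X Y : C} (q : X ⟶ Y), ExtremalEpi q → X ∈ P.T → Y ∈ P.T) ∧
    (∀ {X Y : C} (m : X ⟶ Y), ExtremalMono m → Y ∈ P.F → X ∈ P.F) := by
  refine ⟨fun {X Y} q hq hX => ?_, fun {X Y} m hm hY => ?_⟩
  · obtain ⟨T₀, F₀, e, f, hT, hF, hker, -⟩ := P.exact_seq Y
    obtain ⟨l, hl, -⟩ := hker.lift q (P.hom_trivial hX hF _)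
    have : IsIso e := hq.2 l e hker.mono hl
    exact P.replete_T (asIso e) hT
  · obtain ⟨T₀, F₀, e, f, hT, hF, -, hcoker⟩ := P.exact_seq X
    obtain ⟨l, hl, -⟩ := hcoker.desc m (P.hom_trivial hT hY _)
    have : IsIso f := hm.2 f l hcoker.epi hl
    exact P.replete_F (asIso f).symm hF
end PretorsionPaper
end

section
/- Let (T, F) be a pretorsion theory in a lextensive category C, let g₁ : X₁ → Y and g₂ : X₂ → Y be Z-trivial morphisms, and let g : X₁ + X₂ → Y be the morphism induced by the universal property of the coproduct. Then g is Z-trivial provided either (a) g admits a Z-kernel, or (b) Z = T ∩ F is closed under binary coproducts. -/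
/- Basic notions of pretorsion theories, after Borceux, Campanini, Gran,
"Pretorsion theories in lextensive categories". -/

namespace PretorsionPaper

open CategoryTheory CategoryTheory.Limits

universe w₂ w₁ v' u' v u

variable {C : Type u} [Category.{v} C]

/-- if `g₁ : X₁ ⟶ Y` and `g₂ : X₂ ⟶ Y` are `Z`-trivial, then the induced
morphism `X₁ ⨿ X₂ ⟶ Y` is `Z`-trivial, provided either (a) it admits a `Z`-kernel, or
(b) `Z` is closed under binary coproducts. -/
theorem trivial_desc_of_trivial [FinitaryExtensive C] [HasFiniteLimits C]
    (P : PretorsionTheory C) {X₁ X₂ Y : C} (g₁ : X₁ ⟶ Y) (g₂ : X₂ ⟶ Y)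
    (h₁ : IsTrivial P.Z g₁) (h₂ : IsTrivial P.Z g₂)
    (h : (∃ (K : C) (k : K ⟶ X₁ ⨿ X₂), IsZKernel P.Z k (coprod.desc g₁ g₂)) ∨
      (∀ A B : C, A ∈ P.Z → B ∈ P.Z → (A ⨿ B) ∈ P.Z)) :
    IsTrivial P.Z (coprod.desc g₁ g₂) := by
  rcases h with ⟨K, k, hk⟩ | hZ
  · obtain ⟨s₁, hs₁, -⟩ := hk.lift (coprod.inl : X₁ ⟶ X₁ ⨿ X₂) (by rwa [coprod.inl_desc])
    obtain ⟨s₂, hs₂, -⟩ := hk.lift (coprod.inr : X₂ ⟶ X₁ ⨿ X₂) (by rwa [coprod.inr_desc])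
    have hs : coprod.desc s₁ s₂ ≫ k = 𝟙 _ := by
      ext <;> simp [hs₁, hs₂]
    obtain ⟨W, p, q, hW, hpq⟩ := hk.comp_trivial
    refine ⟨W, coprod.desc s₁ s₂ ≫ p, q, hW, ?_⟩
    rw [Category.assoc, hpq, ← Category.assoc, hs, Category.id_comp]
  · obtain ⟨W₁, p₁, q₁, hW₁, rfl⟩ := h₁
    obtain ⟨W₂, p₂, q₂, hW₂, rfl⟩ := h₂
    exact ⟨W₁ ⨿ W₂, coprod.map p₁ p₂, coprod.desc q₁ q₂, hZ _ _ hW₁ hW₂,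
      coprod.map_desc _ _ _ _⟩
end PretorsionPaper
end

section
/- Let C be a lextensive category with a pretorsion theory (T, F) such that Z := T ∩ F is closed under binary coproducts and under complemented subobjects. Then the relation ~ is a congruence on the category Par(C) of partial morphisms: it is an equivalence relation on each hom-set, and it is compatible with composition on both sides (if (α₁, f₁) ~ (α₂, f₂) : X → Y, then (β, g)∘(α₁, f₁) ~ (β, g)∘(α₂, f₂) for every (β, g) : Y → Z, and (α₁, f₁)∘(β, g) ~ (α₂, f₂)∘(β, g) for every (β, g) : W → X). -/
/- Basic notions of pretorsion theories, after Borceux, Campanini, Gran,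
"Pretorsion theories in lextensive categories". -/

namespace PretorsionPaper

open CategoryTheory CategoryTheory.Limits

universe w₂ w₁ v' u' v u

variable {C : Type u} [Category.{v} C]

/-- A morphism `β : B ⟶ Y` is a coproduct coprojection (equivalently, exhibits `B` as a
complemented subobject of `Y`) if there are `B'` and `β' : B' ⟶ Y` making `Y` a
coproduct of `B` and `B'` with coprojections `β`, `β'`. -/
def IsCoprodInclusion {B Y : C} (β : B ⟶ Y) : Prop :=
  ∃ (B' : C) (β' : B' ⟶ Y), Nonempty (IsColimit (BinaryCofan.mk β β'))

/-- A representative of a partial morphism `X ⇀ Y`: a subobject-domain `dom` with an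
inclusion `incl : dom ⟶ X` and a morphism `map : dom ⟶ Y`. -/
structure ParHom (X Y : C) where
  dom : C
  incl : dom ⟶ X
  map : dom ⟶ Y

/-- A partial morphism representative is valid when its inclusion is a complemented
subobject (a coproduct coprojection). -/
def ParHom.IsValid {X Y : C} (p : ParHom X Y) : Prop := IsCoprodInclusion p.incl

/-- The total partial morphism associated with an ordinary morphism (this is the
action of the functor `I : C ⟶ Par(C)`, and `Σ f` is its congruence class). -/
def ParHom.ofHom {X Y : C} (f : X ⟶ Y) : ParHom X Y := ⟨X, 𝟙 X, f⟩

/-- Composition of partial morphism representatives, via the chosen pullback. -/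
noncomputable def ParHom.comp [HasPullbacks C] {X Y W : C}
    (p : ParHom X Y) (q : ParHom Y W) : ParHom X W where
  dom := pullback p.map q.incl
  incl := pullback.fst p.map q.incl ≫ p.incl
  map := pullback.snd p.map q.incl ≫ q.map

/-- The zero partial morphism `X ⇀ Y`, factoring through the initial object. -/
noncomputable def ParHom.zero [HasInitial C] (X Y : C) : ParHom X Y :=
  ⟨⊥_ C, initial.to X, initial.to Y⟩

/-- The congruence relation on partial morphism representatives: there is a common
complemented subobject `Cm` of the two domains (with complements `C₁`, `C₂`),
compatibly included in `X`, on which the two morphisms agree, and on the complements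
the morphisms are `Z`-trivial. -/
def ParEquiv (Z : Set C) {X Y : C} (p q : ParHom X Y) : Prop :=
  ∃ (Cm C₁ C₂ : C) (γ₁ : Cm ⟶ p.dom) (δ₁ : C₁ ⟶ p.dom) (γ₂ : Cm ⟶ q.dom) (δ₂ : C₂ ⟶ q.dom),
    Nonempty (IsColimit (BinaryCofan.mk γ₁ δ₁)) ∧
    Nonempty (IsColimit (BinaryCofan.mk γ₂ δ₂)) ∧
    γ₁ ≫ p.incl = γ₂ ≫ q.incl ∧
    γ₁ ≫ p.map = γ₂ ≫ q.map ∧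
    IsTrivial Z (δ₁ ≫ p.map) ∧
    IsTrivial Z (δ₂ ≫ q.map)

theorem IsTrivial.comp_left {Z : Set C} {X Y W : C} {f : X ⟶ Y} (hf : IsTrivial Z f)
    (u : W ⟶ X) : IsTrivial Z (u ≫ f) := by
  obtain ⟨A, g, h, hA, rfl⟩ := hf
  exact ⟨A, u ≫ g, h, hA, Category.assoc _ _ _⟩

theorem IsTrivial.comp_right {Z : Set C} {X Y W : C} {f : X ⟶ Y} (hf : IsTrivial Z f)
    (u : Y ⟶ W) : IsTrivial Z (f ≫ u) := by
  obtain ⟨A, g, h, hA, rfl⟩ := hf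
  exact ⟨A, g, h ≫ u, hA, (Category.assoc _ _ _).symm⟩

theorem IsTrivial.coprod_desc [HasBinaryCoproducts C] {Z : Set C}
    (hZ : ∀ A B : C, A ∈ Z → B ∈ Z → (A ⨿ B) ∈ Z) {X₁ X₂ Y : C} {f₁ : X₁ ⟶ Y} {f₂ : X₂ ⟶ Y}
    (h₁ : IsTrivial Z f₁) (h₂ : IsTrivial Z f₂) : IsTrivial Z (coprod.desc f₁ f₂) := by
  obtain ⟨A₁, g₁, k₁, hA₁, rfl⟩ := h₁
  obtain ⟨A₂, g₂, k₂, hA₂, rfl⟩ := h₂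
  exact ⟨A₁ ⨿ A₂, coprod.map g₁ g₂, coprod.desc k₁ k₂, hZ _ _ hA₁ hA₂, by simp⟩

theorem PretorsionTheory.mem_Z_of_iso (P : PretorsionTheory C) {X Y : C} (e : X ≅ Y)
    (hX : X ∈ P.Z) : Y ∈ P.Z :=
  ⟨P.replete_T e hX.1, P.replete_F e hX.2⟩

theorem PretorsionTheory.mem_Z_of_isCoprodInclusion [HasBinaryCoproducts C]
    (P : PretorsionTheory C) (hZ : ∀ A B : C, (A ⨿ B) ∈ P.Z → A ∈ P.Z ∧ B ∈ P.Z)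
    {A X : C} {i : A ⟶ X} (hi : IsCoprodInclusion i) (hX : X ∈ P.Z) : A ∈ P.Z := by
  obtain ⟨A', i', ⟨h⟩⟩ := hi
  exact (hZ A A' (P.mem_Z_of_iso
    (h.coconePointUniqueUpToIso (colimit.isColimit (pair A A'))) hX)).1

theorem PretorsionTheory.isTrivial_of_isInitial [HasBinaryCoproducts C]
    (P : PretorsionTheory C) (hZ : ∀ A B : C, (A ⨿ B) ∈ P.Z → A ∈ P.Z ∧ B ∈ P.Z)
    {I X : C} (hI : IsInitial I) (f : I ⟶ X) : IsTrivial P.Z f := by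
  obtain ⟨_, _, _, _, -, -, hk, -⟩ := P.exact_seq X
  obtain ⟨W, -, -, hW, -⟩ := hk.comp_trivial
  have hi : IsCoprodInclusion (hI.to W) :=
    ⟨W, 𝟙 W, (BinaryCofan.isColimit_iff_isIso_inr hI _).2 (inferInstanceAs (IsIso (𝟙 W)))⟩
  exact ⟨I, 𝟙 I, f, P.mem_Z_of_isCoprodInclusion hZ hi hW, Category.id_comp f⟩

/-- Coproduct decompositions are stable under pullback. -/
theorem nonempty_isColimit_of_isPullback [FinitaryExtensive C] {A B X A' B' X' : C}
    {a : A ⟶ X} {b : B ⟶ X} (h : Nonempty (IsColimit (BinaryCofan.mk a b))) {f : X' ⟶ X}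
    {a' : A' ⟶ X'} {u : A' ⟶ A} {b' : B' ⟶ X'} {v : B' ⟶ B}
    (ha : IsPullback a' u f a) (hb : IsPullback b' v f b) :
    Nonempty (IsColimit (BinaryCofan.mk a' b')) :=
  ((BinaryCofan.isVanKampen_iff _).1 (FinitaryExtensive.vanKampen _ h.some)
    (BinaryCofan.mk a' b') u v f ha.w.symm hb.w.symm).2 ⟨ha, hb⟩

theorem IsCoprodInclusion.of_isPullback [FinitaryExtensive C] [HasPullbacks C]
    {A X A' X' : C} {a : A ⟶ X} (h : IsCoprodInclusion a) {f : X' ⟶ X} {a' : A' ⟶ X'}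
    {u : A' ⟶ A} (ha : IsPullback a' u f a) : IsCoprodInclusion a' := by
  obtain ⟨B, b, h⟩ := h
  exact ⟨_, _, nonempty_isColimit_of_isPullback h ha (IsPullback.of_hasPullback f b)⟩

/-- Reassociation of coproduct decompositions: if `X = A + D` and `A = E + E'`, then
`X = E + (E' + D)`. -/
theorem nonempty_isColimit_coprod_assoc [HasBinaryCoproducts C] {X A D E E' : C}
    {a : A ⟶ X} {d : D ⟶ X} {e : E ⟶ A} {e' : E' ⟶ A}
    (h : Nonempty (IsColimit (BinaryCofan.mk a d)))
    (h' : Nonempty (IsColimit (BinaryCofan.mk e e'))) :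
    Nonempty (IsColimit (BinaryCofan.mk (e ≫ a) (coprod.desc (e' ≫ a) d))) := by
  obtain ⟨h⟩ := h
  obtain ⟨h'⟩ := h'
  have desc {T : C} (f : E ⟶ T) (g : E' ⨿ D ⟶ T) :
      ∃ m : X ⟶ T, (e ≫ a) ≫ m = f ∧ coprod.desc (e' ≫ a) d ≫ m = g := by
    obtain ⟨l, hl, hl'⟩ : ∃ l : A ⟶ T, e ≫ l = f ∧ e' ≫ l = coprod.inl ≫ g :=
      ⟨_, (BinaryCofan.IsColimit.desc' h' f (coprod.inl ≫ g)).2⟩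
    obtain ⟨m, hm, hm'⟩ : ∃ m : X ⟶ T, a ≫ m = l ∧ d ≫ m = coprod.inr ≫ g :=
      ⟨_, (BinaryCofan.IsColimit.desc' h l (coprod.inr ≫ g)).2⟩
    exact ⟨m, by simp [hm, hl], coprod.hom_ext
      (by rw [coprod.inl_desc_assoc, Category.assoc, hm, hl'])
      (by rw [coprod.inr_desc_assoc, hm'])⟩
  have ext {T : C} {m n : X ⟶ T} (h₁ : (e ≫ a) ≫ m = (e ≫ a) ≫ n)
      (h₂ : coprod.desc (e' ≫ a) d ≫ m = coprod.desc (e' ≫ a) d ≫ n) : m = n := by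
    have hl := congrArg (coprod.inl ≫ ·) h₂
    have hr := congrArg (coprod.inr ≫ ·) h₂
    simp only [coprod.inl_desc_assoc, coprod.inr_desc_assoc, Category.assoc] at h₁ hl hr
    exact BinaryCofan.IsColimit.hom_ext h (BinaryCofan.IsColimit.hom_ext h' h₁ hl) hr
  choose m hm hm' using @desc
  exact ⟨BinaryCofan.IsColimit.mk _ m hm hm' fun f g n hn hn' =>
    ext (hn.trans (hm f g).symm) (hn'.trans (hm' f g).symm)⟩

theorem isTrivial_pullback_snd [FinitaryExtensive C] [HasPullbacks C] (P : PretorsionTheory C)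
    (hZ : ∀ A B : C, (A ⨿ B) ∈ P.Z → A ∈ P.Z ∧ B ∈ P.Z) {X Y B : C} {f : X ⟶ Y} {i : B ⟶ Y}
    (hf : IsTrivial P.Z f) (hi : IsCoprodInclusion i) : IsTrivial P.Z (pullback.snd f i) := by
  obtain ⟨W, g, h, hW, rfl⟩ := hf
  have hpb := IsPullback.of_hasPullback h i
  exact ⟨pullback h i, pullback.lift (pullback.fst (g ≫ h) i ≫ g) (pullback.snd (g ≫ h) i)
    (by rw [Category.assoc, pullback.condition]), pullback.snd h i,
    P.mem_Z_of_isCoprodInclusion hZ (hi.of_isPullback hpb) hW,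
    pullback.lift_snd _ _ _⟩

theorem ParEquiv.refl [HasInitial C] [HasBinaryCoproducts C] (P : PretorsionTheory C)
    (hZ : ∀ A B : C, (A ⨿ B) ∈ P.Z → A ∈ P.Z ∧ B ∈ P.Z) {X Y : C} (p : ParHom X Y) :
    ParEquiv P.Z p p := by
  have h : Nonempty (IsColimit (BinaryCofan.mk (𝟙 p.dom) (initial.to p.dom))) :=
    (BinaryCofan.isColimit_iff_isIso_inl initialIsInitial _).2 (inferInstanceAs (IsIso (𝟙 _)))
  exact ⟨_, _, _, _, _, _, _, h, h, rfl, rfl, P.isTrivial_of_isInitial hZ initialIsInitial _,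
    P.isTrivial_of_isInitial hZ initialIsInitial _⟩

theorem ParEquiv.symm {Z : Set C} {X Y : C} {p q : ParHom X Y} (h : ParEquiv Z p q) :
    ParEquiv Z q p := by
  obtain ⟨_, _, _, _, _, _, _, h₁, h₂, hi, hm, ht₁, ht₂⟩ := h
  exact ⟨_, _, _, _, _, _, _, h₂, h₁, hi.symm, hm.symm, ht₂, ht₁⟩

theorem ParEquiv.trans [FinitaryExtensive C] [HasPullbacks C] {Z : Set C}
    (hZ : ∀ A B : C, A ∈ Z → B ∈ Z → (A ⨿ B) ∈ Z) {X Y : C} {p q r : ParHom X Y}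
    (hpq : ParEquiv Z p q) (hqr : ParEquiv Z q r) : ParEquiv Z p r := by
  obtain ⟨A, A₁, A₂, a₁, a₁', a₂, a₂', h₁, h₂, hi, hm, ht₁, ht₂⟩ := hpq
  obtain ⟨B, B₂, B₃, b₂, b₂', b₃, b₃', k₂, k₃, ki, km, kt₂, kt₃⟩ := hqr
  have hA := nonempty_isColimit_of_isPullback k₂ (IsPullback.of_hasPullback a₂ b₂)
    (IsPullback.of_hasPullback a₂ b₂')
  have hB := nonempty_isColimit_of_isPullback h₂ (IsPullback.of_hasPullback a₂ b₂).flip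
    (IsPullback.of_hasPullback b₂ a₂')
  refine ⟨_, _, _, _, _, _, _, nonempty_isColimit_coprod_assoc h₁ hA,
    nonempty_isColimit_coprod_assoc k₃ hB, ?_, ?_, ?_, ?_⟩
  · simp only [Category.assoc, hi, ← ki, pullback.condition_assoc]
  · simp only [Category.assoc, hm, ← km, pullback.condition_assoc]
  · rw [coprod.desc_comp, Category.assoc, hm, pullback.condition_assoc]
    exact (kt₂.comp_left _).coprod_desc hZ ht₁
  · rw [coprod.desc_comp, Category.assoc, ← km, pullback.condition_assoc]
    exact (ht₂.comp_left _).coprod_desc hZ kt₃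

/-- A morphism `e` into `D` base changes along the projection `D ×_Y B ⟶ D`. -/
theorem exists_isPullback_pullback_fst [HasPullbacks C] {B D E Y : C} (f : D ⟶ Y) (i : B ⟶ Y)
    {e : E ⟶ D} {k : E ⟶ Y} (hk : e ≫ f = k) :
    ∃ s : pullback k i ⟶ pullback f i, s ≫ pullback.fst f i = pullback.fst k i ≫ e ∧
      s ≫ pullback.snd f i = pullback.snd k i ∧
      IsPullback s (pullback.fst k i) (pullback.fst f i) e := by
  subst hk
  have h := (IsPullback.of_hasPullback f i).flip
  have h' := (IsPullback.of_hasPullback (e ≫ f) i).flip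
  exact ⟨_, h.lift_snd _ _ _, h.lift_fst _ _ _, h'.of_right' h⟩

theorem exists_isPullback_pullback_snd [HasPullbacks C] {B D E X : C} (f : B ⟶ X) (i : D ⟶ X)
    {e : E ⟶ D} {k : E ⟶ X} (hk : e ≫ i = k) :
    ∃ s : pullback f k ⟶ pullback f i, s ≫ pullback.fst f i = pullback.fst f k ∧
      s ≫ pullback.snd f i = pullback.snd f k ≫ e ∧
      IsPullback s (pullback.snd f k) (pullback.snd f i) e := by
  subst hk
  have h := IsPullback.of_hasPullback f i
  have h' := IsPullback.of_hasPullback f (e ≫ i)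
  exact ⟨_, h.lift_fst _ _ _, h.lift_snd _ _ _, h'.of_right' h⟩

theorem ParEquiv.comp_right [FinitaryExtensive C] [HasPullbacks C] (P : PretorsionTheory C)
    (hZ : ∀ A B : C, (A ⨿ B) ∈ P.Z → A ∈ P.Z ∧ B ∈ P.Z) {X Y W : C} {p₁ p₂ : ParHom X Y}
    (h : ParEquiv P.Z p₁ p₂) {g : ParHom Y W} (hg : g.IsValid) :
    ParEquiv P.Z (p₁.comp g) (p₂.comp g) := by
  obtain ⟨A, A₁, A₂, a₁, a₁', a₂, a₂', h₁, h₂, hi, hm, ht₁, ht₂⟩ := h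
  obtain ⟨s₁, hs₁, hs₁', hp₁⟩ := exists_isPullback_pullback_fst p₁.map g.incl hm
  obtain ⟨t₁, -, ht₁', hq₁⟩ := exists_isPullback_pullback_fst p₁.map g.incl (e := a₁') rfl
  obtain ⟨s₂, hs₂, hs₂', hp₂⟩ := exists_isPullback_pullback_fst p₂.map g.incl (e := a₂) rfl
  obtain ⟨t₂, -, ht₂', hq₂⟩ := exists_isPullback_pullback_fst p₂.map g.incl (e := a₂') rfl
  refine ⟨_, _, _, s₁, t₁, s₂, t₂, nonempty_isColimit_of_isPullback h₁ hp₁ hq₁,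
    nonempty_isColimit_of_isPullback h₂ hp₂ hq₂, ?_, ?_, ?_, ?_⟩
  · change s₁ ≫ pullback.fst p₁.map g.incl ≫ p₁.incl =
      s₂ ≫ pullback.fst p₂.map g.incl ≫ p₂.incl
    rw [reassoc_of% hs₁, reassoc_of% hs₂, hi]
  · change s₁ ≫ pullback.snd p₁.map g.incl ≫ g.map = s₂ ≫ pullback.snd p₂.map g.incl ≫ g.map
    rw [reassoc_of% hs₁', reassoc_of% hs₂']
  · change IsTrivial P.Z (t₁ ≫ pullback.snd p₁.map g.incl ≫ g.map)
    rw [reassoc_of% ht₁']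
    exact (isTrivial_pullback_snd P hZ ht₁ hg).comp_right g.map
  · change IsTrivial P.Z (t₂ ≫ pullback.snd p₂.map g.incl ≫ g.map)
    rw [reassoc_of% ht₂']
    exact (isTrivial_pullback_snd P hZ ht₂ hg).comp_right g.map

theorem ParEquiv.comp_left [FinitaryExtensive C] [HasPullbacks C] {Z : Set C} {V X Y : C}
    (g : ParHom V X) {p₁ p₂ : ParHom X Y} (h : ParEquiv Z p₁ p₂) :
    ParEquiv Z (g.comp p₁) (g.comp p₂) := by
  obtain ⟨A, A₁, A₂, a₁, a₁', a₂, a₂', h₁, h₂, hi, hm, ht₁, ht₂⟩ := h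
  obtain ⟨s₁, hs₁, hs₁', hp₁⟩ := exists_isPullback_pullback_snd g.map p₁.incl hi
  obtain ⟨t₁, -, ht₁', hq₁⟩ := exists_isPullback_pullback_snd g.map p₁.incl (e := a₁') rfl
  obtain ⟨s₂, hs₂, hs₂', hp₂⟩ := exists_isPullback_pullback_snd g.map p₂.incl (e := a₂) rfl
  obtain ⟨t₂, -, ht₂', hq₂⟩ := exists_isPullback_pullback_snd g.map p₂.incl (e := a₂') rfl
  refine ⟨_, _, _, s₁, t₁, s₂, t₂, nonempty_isColimit_of_isPullback h₁ hp₁ hq₁,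
    nonempty_isColimit_of_isPullback h₂ hp₂ hq₂, ?_, ?_, ?_, ?_⟩
  · change s₁ ≫ pullback.fst g.map p₁.incl ≫ g.incl = s₂ ≫ pullback.fst g.map p₂.incl ≫ g.incl
    rw [reassoc_of% hs₁, reassoc_of% hs₂]
  · change s₁ ≫ pullback.snd g.map p₁.incl ≫ p₁.map = s₂ ≫ pullback.snd g.map p₂.incl ≫ p₂.map
    rw [reassoc_of% hs₁', reassoc_of% hs₂', hm]
  · change IsTrivial Z (t₁ ≫ pullback.snd g.map p₁.incl ≫ p₁.map)
    rw [reassoc_of% ht₁']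
    exact ht₁.comp_left _
  · change IsTrivial Z (t₂ ≫ pullback.snd g.map p₂.incl ≫ p₂.map)
    rw [reassoc_of% ht₂']
    exact ht₂.comp_left _

/-- if `Z` is closed under binary coproducts and complemented
subobjects, the relation `~` is a congruence on `Par(C)`: it is reflexive, symmetric
and transitive on (valid) partial morphisms, and compatible with composition on both
sides. -/
theorem parEquiv_is_congruence
    [FinitaryExtensive C] [HasFiniteLimits C] (P : PretorsionTheory C)
    (hZcoprod : ∀ A B : C, A ∈ P.Z → B ∈ P.Z → (A ⨿ B) ∈ P.Z)
    (hZcompl : ∀ A B : C, (A ⨿ B) ∈ P.Z → A ∈ P.Z ∧ B ∈ P.Z) :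
    (∀ {X Y : C} (p : ParHom X Y), p.IsValid → ParEquiv P.Z p p) ∧
    (∀ {X Y : C} (p q : ParHom X Y), ParEquiv P.Z p q → ParEquiv P.Z q p) ∧
    (∀ {X Y : C} (p q r : ParHom X Y), p.IsValid → q.IsValid → r.IsValid →
      ParEquiv P.Z p q → ParEquiv P.Z q r → ParEquiv P.Z p r) ∧
    (∀ {X Y W : C} (p₁ p₂ : ParHom X Y) (g : ParHom Y W),
      p₁.IsValid → p₂.IsValid → g.IsValid →
      ParEquiv P.Z p₁ p₂ → ParEquiv P.Z (p₁.comp g) (p₂.comp g)) ∧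
    (∀ {V X Y : C} (g : ParHom V X) (p₁ p₂ : ParHom X Y),
      p₁.IsValid → p₂.IsValid → g.IsValid →
      ParEquiv P.Z p₁ p₂ → ParEquiv P.Z (g.comp p₁) (g.comp p₂)) := by
  exact ⟨fun p _ => .refl P hZcompl p, fun _ _ h => h.symm,
    fun _ _ _ _ _ _ h h' => h.trans hZcoprod h',
    fun _ _ _ _ _ hg h => h.comp_right P hZcompl hg,
    fun g _ _ _ _ _ h => h.comp_left g⟩

end PretorsionPaper
end

section
/- Let C be a lextensive category with a pretorsion theory (T, F) such that Z := T ∩ F is closed under binary coproducts and under complemented subobjects. Then the functor Σ : C → Stab(C) preserves finite coproducts: it preserves the initial object, and for all objects X, Y of C the images under Σ of the coprojections X → X + Y ← Y exhibit Σ(X + Y) as a coproduct of Σ(X) and Σ(Y) in Stab(C). -/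
/- Basic notions of pretorsion theories, after Borceux, Campanini, Gran,
"Pretorsion theories in lextensive categories". -/

namespace PretorsionPaper

open CategoryTheory CategoryTheory.Limits

universe w₂ w₁ v' u' v u

variable {C : Type u} [Category.{v} C]

lemma nonempty_isColimit_mk_iff {A B Y : C} {a : A ⟶ Y} {b : B ⟶ Y} :
    Nonempty (IsColimit (BinaryCofan.mk a b)) ↔
      ∀ {W : C} (f : A ⟶ W) (g : B ⟶ W), ∃! k : Y ⟶ W, a ≫ k = f ∧ b ≫ k = g := by
  refine ⟨fun ⟨h⟩ W f g => ?_, fun h => ?_⟩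
  · obtain ⟨k, hf, hg⟩ := BinaryCofan.IsColimit.desc' h f g
    refine ⟨k, ⟨hf, hg⟩, fun k' hk' => BinaryCofan.IsColimit.hom_ext h ?_ ?_⟩
    · exact hk'.1.trans hf.symm
    · exact hk'.2.trans hg.symm
  · exact ⟨BinaryCofan.IsColimit.mk _ (fun f g => (h f g).choose)
      (fun f g => (h f g).choose_spec.1.1) (fun f g => (h f g).choose_spec.1.2)
      (fun f g k hf hg => (h f g).choose_spec.2 k ⟨hf, hg⟩)⟩

/-- Coproduct decompositions of the two summands of a coproduct assemble to a coproduct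
decomposition of the whole. -/
lemma nonempty_isColimit_desc [HasBinaryCoproducts C] {A A₁ A₂ M₁ N₁ M₂ N₂ : C}
    {a₁ : A₁ ⟶ A} {a₂ : A₂ ⟶ A} {m₁ : M₁ ⟶ A₁} {n₁ : N₁ ⟶ A₁} {m₂ : M₂ ⟶ A₂} {n₂ : N₂ ⟶ A₂}
    (h : Nonempty (IsColimit (BinaryCofan.mk a₁ a₂)))
    (h₁ : Nonempty (IsColimit (BinaryCofan.mk m₁ n₁)))
    (h₂ : Nonempty (IsColimit (BinaryCofan.mk m₂ n₂))) :
    Nonempty (IsColimit (BinaryCofan.mk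
      (coprod.desc (m₁ ≫ a₁) (m₂ ≫ a₂)) (coprod.desc (n₁ ≫ a₁) (n₂ ≫ a₂)))) := by
  rw [nonempty_isColimit_mk_iff] at h h₁ h₂ ⊢
  intro W f g
  obtain ⟨k₁, ⟨hf₁, hg₁⟩, u₁⟩ := h₁ (coprod.inl ≫ f) (coprod.inl ≫ g)
  obtain ⟨k₂, ⟨hf₂, hg₂⟩, u₂⟩ := h₂ (coprod.inr ≫ f) (coprod.inr ≫ g)
  obtain ⟨k, ⟨e₁, e₂⟩, u⟩ := h k₁ k₂
  refine ⟨k, ⟨?_, ?_⟩, ?_⟩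
  · ext <;> simp [coprod.inl_desc, coprod.inr_desc, e₁, e₂, hf₁, hf₂]
  · ext <;> simp [coprod.inl_desc, coprod.inr_desc, e₁, e₂, hg₁, hg₂]
  · rintro l ⟨rfl, rfl⟩
    exact u _ ⟨u₁ _ (by simp [coprod.inl_desc]), u₂ _ (by simp [coprod.inr_desc])⟩

lemma IsTrivial.coprod_desc_s15 [HasBinaryCoproducts C] {Z : Set C}
    (hZ : ∀ A B : C, A ∈ Z → B ∈ Z → (A ⨿ B) ∈ Z) {X Y W : C} {f : X ⟶ W} {g : Y ⟶ W}
    (hf : IsTrivial Z f) (hg : IsTrivial Z g) : IsTrivial Z (coprod.desc f g) := by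
  obtain ⟨U, a, b, hU, rfl⟩ := hf
  obtain ⟨V, c, d, hV, rfl⟩ := hg
  exact ⟨U ⨿ V, coprod.map a c, coprod.desc b d, hZ _ _ hU hV, by simp⟩

lemma PretorsionTheory.initial_mem_Z [HasInitial C] [HasBinaryCoproducts C]
    (P : PretorsionTheory C) (hZ : ∀ A B : C, (A ⨿ B) ∈ P.Z → A ∈ P.Z ∧ B ∈ P.Z) :
    (⊥_ C) ∈ P.Z := by
  obtain ⟨_, _, _, _, -, -, hk, -⟩ := P.exact_seq (⊥_ C)
  obtain ⟨W, -, -, hW, -⟩ := hk.comp_trivial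
  have e : W ≅ W ⨿ ⊥_ C := (coprod.rightUnitor W).symm
  exact (hZ W (⊥_ C) ⟨P.replete_T e hW.1, P.replete_F e hW.2⟩).2

/-- Isomorphic representatives are congruent. -/
lemma ParEquiv.of_iso [HasInitial C] {Z : Set C} {X Y : C} {p q : ParHom X Y}
    (hZ : (⊥_ C) ∈ Z) (e : p.dom ≅ q.dom)
    (hincl : e.hom ≫ q.incl = p.incl) (hmap : e.hom ≫ q.map = p.map) : ParEquiv Z p q := by
  refine ⟨p.dom, ⊥_ C, ⊥_ C, 𝟙 _, initial.to _, e.hom, initial.to _, ?_, ?_, ?_, ?_,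
    ⟨_, 𝟙 _, _, hZ, Category.id_comp _⟩, ⟨_, 𝟙 _, _, hZ, Category.id_comp _⟩⟩
  · rw [BinaryCofan.isColimit_iff_isIso_inl initialIsInitial]
    exact inferInstanceAs (IsIso (𝟙 p.dom))
  · rw [BinaryCofan.isColimit_iff_isIso_inl initialIsInitial]
    exact inferInstanceAs (IsIso e.hom)
  · simp [hincl]
  · simp [hmap]

/-- Restricting `q` along `f` gives `p` as soon as `p` is the pullback of `q`. -/
lemma ParEquiv.ofHom_comp_of_isPullback [HasInitial C] [HasPullbacks C] {Z : Set C}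
    (hZ : (⊥_ C) ∈ Z) {X Y W : C} {f : X ⟶ Y} {p : ParHom X W} {q : ParHom Y W}
    {i : p.dom ⟶ q.dom} (h : IsPullback p.incl i f q.incl) (hmap : i ≫ q.map = p.map) :
    ParEquiv Z ((ParHom.ofHom f).comp q) p := by
  refine ParEquiv.of_iso hZ h.isoPullback.symm ?_ ?_
  · change h.isoPullback.inv ≫ p.incl = pullback.fst f q.incl ≫ 𝟙 X
    simp
  · change h.isoPullback.inv ≫ p.map = pullback.snd f q.incl ≫ q.map
    simp [← hmap]

/-- Congruence of partial morphisms can be checked on the summands of decompositions of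
their domains. -/
lemma ParEquiv.of_isColimit [HasBinaryCoproducts C] {Z : Set C}
    (hZ : ∀ A B : C, A ∈ Z → B ∈ Z → (A ⨿ B) ∈ Z)
    {X Y V W : C} {p p' : ParHom X W} {q q' : ParHom Y W} {h h' : ParHom V W}
    {f : X ⟶ V} {g : Y ⟶ V} {i : p.dom ⟶ h.dom} {j : q.dom ⟶ h.dom}
    {i' : p'.dom ⟶ h'.dom} {j' : q'.dom ⟶ h'.dom}
    (hij : Nonempty (IsColimit (BinaryCofan.mk i j)))
    (hij' : Nonempty (IsColimit (BinaryCofan.mk i' j')))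
    (hi : i ≫ h.incl = p.incl ≫ f) (hj : j ≫ h.incl = q.incl ≫ g)
    (hi' : i' ≫ h'.incl = p'.incl ≫ f) (hj' : j' ≫ h'.incl = q'.incl ≫ g)
    (mi : i ≫ h.map = p.map) (mj : j ≫ h.map = q.map)
    (mi' : i' ≫ h'.map = p'.map) (mj' : j' ≫ h'.map = q'.map)
    (hp : ParEquiv Z p p') (hq : ParEquiv Z q q') : ParEquiv Z h h' := by
  obtain ⟨M, A, A', m, a, m', a', hma, hma', ip, mp, ta, ta'⟩ := hp
  obtain ⟨N, B, B', n, b, n', b', hnb, hnb', iq, mq, tb, tb'⟩ := hq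
  refine ⟨M ⨿ N, A ⨿ B, A' ⨿ B', _, _, _, _, nonempty_isColimit_desc hij hma hnb,
    nonempty_isColimit_desc hij' hma' hnb', ?_, ?_, ?_, ?_⟩
  · simp [hi, hi', hj, hj', reassoc_of% ip, reassoc_of% iq]
  · simp [mi, mi', mj, mj', mp, mq]
  · simpa [mi, mj] using ta.coprod_desc_s15 hZ tb
  · simpa [mi', mj'] using ta'.coprod_desc_s15 hZ tb'

lemma nonempty_isColimit_pullback_snd [FinitaryExtensive C] [HasPullbacks C] {X Y A : C}
    (f : A ⟶ X ⨿ Y) :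
    Nonempty (IsColimit (BinaryCofan.mk
      (pullback.snd (coprod.inl : X ⟶ X ⨿ Y) f) (pullback.snd (coprod.inr : Y ⟶ X ⨿ Y) f))) :=
  ((BinaryCofan.isVanKampen_iff _).mp (FinitaryExtensive.vanKampen _ (coprodIsCoprod X Y))
    (BinaryCofan.mk (pullback.snd (coprod.inl : X ⟶ X ⨿ Y) f)
      (pullback.snd (coprod.inr : Y ⟶ X ⨿ Y) f)) (pullback.fst _ _)
    (pullback.fst _ _) f pullback.condition pullback.condition).mpr
    ⟨(IsPullback.of_hasPullback coprod.inl f).flip, (IsPullback.of_hasPullback coprod.inr f).flip⟩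

lemma ParHom.snd_comp_incl_ofHom_comp [HasPullbacks C] {X Y W : C} (f : X ⟶ Y) (q : ParHom Y W) :
    pullback.snd f q.incl ≫ q.incl = ((ParHom.ofHom f).comp q).incl ≫ f := by
  change _ = (pullback.fst f q.incl ≫ 𝟙 X) ≫ f
  simp [pullback.condition]

/-- the functor `Σ : C ⟶ Stab(C)` preserves finite coproducts: the
initial object becomes initial (any two morphisms out of it are congruent) and, for
objects `X`, `Y`, the images of the coprojections `X ⟶ X ⨿ Y ⟵ Y` exhibit
`Σ(X ⨿ Y)` as a coproduct of `Σ X` and `Σ Y` in the stable category, i.e. morphisms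
out of `X ⨿ Y` correspond, uniquely up to congruence, to pairs of morphisms out of
`X` and `Y`. -/
theorem sigma_preserves_finite_coproducts
    [FinitaryExtensive C] [HasFiniteLimits C] (P : PretorsionTheory C)
    (hZcoprod : ∀ A B : C, A ∈ P.Z → B ∈ P.Z → (A ⨿ B) ∈ P.Z)
    (hZcompl : ∀ A B : C, (A ⨿ B) ∈ P.Z → A ∈ P.Z ∧ B ∈ P.Z) :
    (∀ (Y : C) (p q : ParHom (⊥_ C) Y), p.IsValid → q.IsValid → ParEquiv P.Z p q) ∧
    (∀ {X Y W : C} (p : ParHom X W) (q : ParHom Y W), p.IsValid → q.IsValid →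
      ∃ h : ParHom (X ⨿ Y) W, h.IsValid ∧
        ParEquiv P.Z ((ParHom.ofHom (coprod.inl : X ⟶ X ⨿ Y)).comp h) p ∧
        ParEquiv P.Z ((ParHom.ofHom (coprod.inr : Y ⟶ X ⨿ Y)).comp h) q ∧
        ∀ h' : ParHom (X ⨿ Y) W, h'.IsValid →
          ParEquiv P.Z ((ParHom.ofHom (coprod.inl : X ⟶ X ⨿ Y)).comp h') p →
          ParEquiv P.Z ((ParHom.ofHom (coprod.inr : Y ⟶ X ⨿ Y)).comp h') q →
          ParEquiv P.Z h' h) := by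
  have h0 := P.initial_mem_Z hZcompl
  refine ⟨fun Y p q _ _ => ?_, fun {X Y W} p q hp hq => ?_⟩
  · have : IsIso p.incl := inferInstance
    have : IsIso q.incl := inferInstance
    have hp : IsInitial p.dom := initialIsInitial.ofIso (asIso p.incl).symm
    exact ParEquiv.of_iso h0 (asIso p.incl ≪≫ (asIso q.incl).symm) (by simp) (hp.hom_ext _ _)
  · obtain ⟨X', x, hx⟩ := hp
    obtain ⟨Y', y, hy⟩ := hq
    let h : ParHom (X ⨿ Y) W :=
      ⟨p.dom ⨿ q.dom, coprod.desc (p.incl ≫ coprod.inl) (q.incl ≫ coprod.inr),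
        coprod.desc p.map q.map⟩
    have hi : coprod.inl ≫ h.incl = p.incl ≫ coprod.inl := coprod.inl_desc _ _
    have hj : coprod.inr ≫ h.incl = q.incl ≫ coprod.inr := coprod.inr_desc _ _
    have hi' : coprod.inl ≫ h.map = p.map := coprod.inl_desc _ _
    have hj' : coprod.inr ≫ h.map = q.map := coprod.inr_desc _ _
    have hpb := ((BinaryCofan.isVanKampen_iff _).mp
      (FinitaryExtensive.vanKampen _ (coprodIsCoprod X Y))
      (BinaryCofan.mk (coprod.inl : p.dom ⟶ p.dom ⨿ q.dom) coprod.inr)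
      p.incl q.incl h.incl hi.symm hj.symm).mp ⟨coprodIsCoprod _ _⟩
    exact ⟨h, ⟨_, _, nonempty_isColimit_desc ⟨coprodIsCoprod X Y⟩ hx hy⟩,
      ParEquiv.ofHom_comp_of_isPullback h0 hpb.1.flip hi',
      ParEquiv.ofHom_comp_of_isPullback h0 hpb.2.flip hj',
      fun h' _ hp hq => ParEquiv.of_isColimit hZcoprod
        (nonempty_isColimit_pullback_snd h'.incl) ⟨coprodIsCoprod _ _⟩
        (ParHom.snd_comp_incl_ofHom_comp _ _) (ParHom.snd_comp_incl_ofHom_comp _ _) hi hj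
        rfl rfl hi' hj' hp hq⟩
end PretorsionPaper
end
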